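/- For every integer k ≥ 1 and parameters ε ∈ (0, 1/2) and η ∈ [0, 1/4), there exist Bernoulli distributions p, q, p', q' (i.e., distributions on {0,1}) together with two probability distributions N^(p) and N^(q) on {0,1}^k such that: (1) Δ(p, q) = 2η + ε/√(2k); (2) Δ(p, p') = Δ(q, q') = η; and (3) (1−ε)·p'^⊗k + ε·N^(p) = (1−ε)·q'^⊗k + ε·N^(q). In particular, one may take p', q' to be Bernoulli with means (1−ε/√(2k))/2 and (1+ε/√(2k))/2, and p, q to be Bernoulli with means (1−ε/√(2k))/2 − η and (1+ε/√(2k))/2 + η. -/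

import Mathlib

open Finset

/-- `p` is a probability distribution on the finite type `α`. -/
def IsDist {α : Type*} [Fintype α] (p : α → ℝ) : Prop :=
  (∀ x, 0 ≤ p x) ∧ ∑ x, p x = 1

/-- Total variation distance between two distributions on a finite type. -/
noncomputable def TV {α : Type*} [Fintype α] (p q : α → ℝ) : ℝ :=
  (1 / 2) * ∑ x, |p x - q x|

/-- Bernoulli distribution on `{0,1}` (encoded as `Bool`) with mean `θ`. -/
def bern (θ : ℝ) : Bool → ℝ := fun b => if b then θ else 1 - θ

theorem isDist_bern {θ : ℝ} (h0 : 0 ≤ θ) (h1 : θ ≤ 1) : IsDist (bern θ) := by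
  refine ⟨fun b => ?_, by simp [bern]⟩
  cases b <;> simp [bern, h0, h1]

theorem TV_bern (a b : ℝ) : TV (bern a) (bern b) = |a - b| := by
  have h : 1 - a - (1 - b) = -(a - b) := by ring
  simp only [TV, bern, Fintype.sum_bool, if_true, Bool.false_eq_true, if_false, h, abs_neg]
  ring

theorem IsDist.pi_prod {α : Type*} [Fintype α] {p : α → ℝ} (hp : IsDist p) (k : ℕ) :
    IsDist fun x : Fin k → α => ∏ i, p (x i) := by
  classical
  refine ⟨fun x => prod_nonneg fun i _ => hp.1 _, ?_⟩
  have h := Fintype.sum_pow p k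
  rw [hp.2, one_pow] at h
  exact h.symm

/-- Le Cam's inequality between total variation and the Bhattacharyya coefficient. -/
theorem sq_TV_le {α : Type*} [Fintype α] {P Q : α → ℝ} (hP : IsDist P) (hQ : IsDist Q) :
    TV P Q ^ 2 ≤ 1 - (∑ x, √(P x * Q x)) ^ 2 := by
  have hsP : ∀ x, √(P x) ^ 2 = P x := fun x => Real.sq_sqrt (hP.1 x)
  have hsQ : ∀ x, √(Q x) ^ 2 = Q x := fun x => Real.sq_sqrt (hQ.1 x)
  have habs : ∀ x, |P x - Q x| = |√(P x) - √(Q x)| * (√(P x) + √(Q x)) := fun x => by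
    have h : 0 ≤ √(P x) + √(Q x) := by positivity
    have hmul := abs_mul (√(P x) - √(Q x)) (√(P x) + √(Q x))
    rw [abs_of_nonneg h] at hmul
    rw [← hmul]
    congr 1
    linear_combination -hsP x + hsQ x
  have hcs := sum_mul_sq_le_sq_mul_sq univ (fun x => |√(P x) - √(Q x)|)
    (fun x => √(P x) + √(Q x))
  have hminus : ∑ x, |√(P x) - √(Q x)| ^ 2 = 2 - 2 * ∑ x, √(P x * Q x) := by
    calc _ = ∑ x, (P x + Q x - 2 * √(P x * Q x)) := sum_congr rfl fun x _ => by
          rw [sq_abs, Real.sqrt_mul (hP.1 x)]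
          linear_combination hsP x + hsQ x
      _ = _ := by
          rw [sum_sub_distrib, sum_add_distrib, hP.2, hQ.2, ← mul_sum]
          ring
  have hplus : ∑ x, (√(P x) + √(Q x)) ^ 2 = 2 + 2 * ∑ x, √(P x * Q x) := by
    calc _ = ∑ x, (P x + Q x + 2 * √(P x * Q x)) := sum_congr rfl fun x _ => by
          rw [Real.sqrt_mul (hP.1 x)]
          linear_combination hsP x + hsQ x
      _ = _ := by
          rw [sum_add_distrib, sum_add_distrib, hP.2, hQ.2, ← mul_sum]
          ring
  rw [hminus, hplus] at hcs
  simp only [← habs] at hcs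
  rw [TV]
  linarith

/-- Distributions at total variation distance at most `ε / (1 - ε)` can be made equal by
contaminating each of them with weight `ε`. -/
theorem exists_contamination {α : Type*} [Fintype α] {P Q : α → ℝ} (hP : IsDist P)
    (hQ : IsDist Q) {ε : ℝ} (hε : 0 < ε) (hε1 : ε ≤ 1) (h : (1 - ε) * TV P Q ≤ ε) :
    ∃ Np Nq : α → ℝ, IsDist Np ∧ IsDist Nq ∧
      ∀ x, (1 - ε) * P x + ε * Np x = (1 - ε) * Q x + ε * Nq x := by
  have key : ∀ A B : α → ℝ, IsDist A → IsDist B → (1 - ε) * TV A B ≤ ε →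
      IsDist fun x => (1 - ε) / ε * ((|A x - B x| + (B x - A x)) / 2) +
        (1 - (1 - ε) / ε * TV A B) * P x := by
    intro A B hA hB hAB
    have h1 : (1 - ε) / ε * TV A B ≤ 1 := by
      rw [div_mul_eq_mul_div, div_le_one hε]
      exact hAB
    have h2 : 0 ≤ (1 - ε) / ε := div_nonneg (by linarith) hε.le
    refine ⟨fun x => ?_, ?_⟩
    · have h3 := neg_abs_le (B x - A x)
      rw [abs_sub_comm] at h3
      exact add_nonneg (mul_nonneg h2 (by linarith))
        (mul_nonneg (by linarith) (hP.1 x))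
    · rw [sum_add_distrib, ← mul_sum, ← mul_sum, hP.2, ← sum_div, sum_add_distrib,
        sum_sub_distrib, hA.2, hB.2, TV]
      ring
  have hcomm : TV Q P = TV P Q := by simp only [TV, abs_sub_comm]
  refine ⟨_, _, key P Q hP hQ h, key Q P hQ hP (by rwa [hcomm]), fun x => ?_⟩
  simp only [hcomm, abs_sub_comm (Q x) (P x)]
  field_simp
  ring

theorem sq_TV_pi_bern_le (k : ℕ) {δ : ℝ} (h0 : 0 ≤ δ) (h1 : δ ≤ 1) :
    TV (fun x : Fin k → Bool => ∏ i, bern ((1 - δ) / 2) (x i))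
      (fun x : Fin k → Bool => ∏ i, bern ((1 + δ) / 2) (x i)) ^ 2 ≤ k * δ ^ 2 := by
  have hP := (isDist_bern (θ := (1 - δ) / 2) (by linarith) (by linarith)).pi_prod k
  have hQ := (isDist_bern (θ := (1 + δ) / 2) (by linarith) (by linarith)).pi_prod k
  refine (sq_TV_le hP hQ).trans ?_
  have hb : ∀ b, bern ((1 - δ) / 2) b * bern ((1 + δ) / 2) b = (1 - δ ^ 2) / 4 := by
    intro b
    cases b <;> simp only [bern, if_true, Bool.false_eq_true, if_false] <;> ring
  have hδ : 0 ≤ 1 - δ ^ 2 := by nlinarith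
  simp only [← prod_mul_distrib, hb, prod_const, sum_const, card_univ, Fintype.card_fin,
    Fintype.card_pi, Fintype.card_bool, nsmul_eq_mul]
  rw [mul_pow, Real.sq_sqrt (by positivity)]
  have hpow : ((2 ^ k : ℕ) : ℝ) ^ 2 * ((1 - δ ^ 2) / 4) ^ k = (1 - δ ^ 2) ^ k := by
    push_cast
    rw [← pow_mul, mul_comm k 2, pow_mul, ← mul_pow]
    congr 1
    ring
  rw [hpow]
  have := one_add_mul_le_pow (a := -δ ^ 2) (by nlinarith) k
  rw [← sub_eq_add_neg] at this
  linarith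

/-- the indistinguishable pair of instances, with the explicit
Bernoulli witnesses of means `(1 ∓ ε/√(2k))/2 ∓ η` and `(1 ∓ ε/√(2k))/2`. -/
theorem stmt_1 (k : ℕ) (hk : 1 ≤ k) (ε η : ℝ)
    (hε : ε ∈ Set.Ioo (0 : ℝ) (1 / 2)) (hη : η ∈ Set.Ico (0 : ℝ) (1 / 4)) :
    ∃ p q p' q' : Bool → ℝ, ∃ Np Nq : (Fin k → Bool) → ℝ,
      IsDist p ∧ IsDist q ∧ IsDist p' ∧ IsDist q' ∧ IsDist Np ∧ IsDist Nq ∧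
      TV p q = 2 * η + ε / Real.sqrt (2 * k) ∧
      TV p p' = η ∧ TV q q' = η ∧
      (∀ x : Fin k → Bool,
        (1 - ε) * ∏ i, p' (x i) + ε * Np x = (1 - ε) * ∏ i, q' (x i) + ε * Nq x) ∧
      p = bern ((1 - ε / Real.sqrt (2 * k)) / 2 - η) ∧
      q = bern ((1 + ε / Real.sqrt (2 * k)) / 2 + η) ∧
      p' = bern ((1 - ε / Real.sqrt (2 * k)) / 2) ∧
      q' = bern ((1 + ε / Real.sqrt (2 * k)) / 2) := by
  obtain ⟨hε0, hε1⟩ := hε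
  obtain ⟨hη0, hη1⟩ := hη
  have hk' : (1 : ℝ) ≤ k := by exact_mod_cast hk
  have hs1 : 1 ≤ √(2 * (k : ℝ)) := Real.one_le_sqrt.2 (by linarith)
  have hsq : (k : ℝ) * (ε / √(2 * (k : ℝ))) ^ 2 = ε ^ 2 / 2 := by
    rw [div_pow, Real.sq_sqrt (by positivity)]
    field_simp
  have hδ0 : 0 ≤ ε / √(2 * (k : ℝ)) := by positivity
  have hδε : ε / √(2 * (k : ℝ)) ≤ ε := div_le_self hε0.le hs1
  generalize ε / √(2 * (k : ℝ)) = δ at *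
  have hp' : IsDist (bern ((1 - δ) / 2)) := isDist_bern (by linarith) (by linarith)
  have hq' : IsDist (bern ((1 + δ) / 2)) := isDist_bern (by linarith) (by linarith)
  have hTV := sq_TV_pi_bern_le k hδ0 (by linarith)
  have hTV' := abs_le_of_sq_le_sq (hTV.trans (by nlinarith : (k : ℝ) * δ ^ 2 ≤ ε ^ 2)) hε0.le
  obtain ⟨Np, Nq, hNp, hNq, hN⟩ := exists_contamination (hp'.pi_prod k) (hq'.pi_prod k) hε0
    (by linarith) (by nlinarith [(abs_le.1 hTV').2])
  refine ⟨_, _, _, _, Np, Nq, isDist_bern (by linarith) (by linarith),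
    isDist_bern (by linarith) (by linarith), hp', hq', hNp, hNq, ?_, ?_, ?_, hN,
    rfl, rfl, rfl, rfl⟩
  · rw [TV_bern, abs_of_nonpos (by linarith)]
    ring
  · rw [TV_bern, abs_of_nonpos (by linarith)]
    ring
  · rw [TV_bern, abs_of_nonneg (by linarith)]
    ring
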